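/- Let n ≥ 1 be an integer, α ∈ (0,1], γ > 0, δ > 0, M₁, M₂, C₁, C₂ > 0. Assume: (u_ε)_{ε∈(0,1)} continuous, 2π-periodic in x, with |u_ε(x,t)| ≤ M₁ for all ε, x, t; (v_ε) continuous, C^∞ in x, 2π-periodic in x, with |v_ε(x,t)| ≤ M₂/ε^α for all ε, x, t; (w_ε) continuous, 2π-periodic in x, with ∫_{−π}^{π}|w_ε(x,t)|dx ≤ C₁/ε^{(n+1)α} for all ε ∈ (0,1) and t ∈ [0,δ]; (Z₀ε) continuous 2π-periodic with ∫_{−π}^{π}|Z₀ε(x)|dx ≤ C₂; and for each ε, Z_ε is a continuously differentiable 2π-periodic curve in C_b(ℝ) with Z_ε(·,0) = Z₀ε and ∂ₜZ_ε(x,t) = (1/ε)[Z_ε(x−ε,t)u_ε(x−ε,t)⁺ − Z_ε(x,t)|u_ε(x,t)| + Z_ε(x+ε,t)u_ε(x+ε,t)⁻] − ∂ₓ[(v_ε(·,t)·w_ε(·,t)) * φ_{ε^γ}](x). Then there is a constant C > 0, independent of ε and t, such that for all ε ∈ (0,1) and t ∈ [0,δ], ∫_{−π}^{π}|Z_ε(x,t)|dx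 ≤ ∫_{−π}^{π}|Z₀ε(x)|dx + t·C/ε^{2γ+(n+2)α}. -/

import Mathlib

open MeasureTheory Set Real

/-- The derivative of the mollification of a periodic function is bounded by its `L¹` norm. -/
lemma abs_deriv_mollify_le {φ : ℝ → ℝ} (hφ : ContDiff ℝ 1 φ) (hφc : HasCompactSupport φ)
    {K : ℝ} (hK : ∀ y, |deriv φ y| ≤ K) {N : ℕ} (hN : ∀ y, N * π < |y| → deriv φ y = 0)
    {h : ℝ} (h0 : 0 < h) (h1 : h ≤ 1) {f : ℝ → ℝ} (hf : Continuous f)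
    (hfp : Function.Periodic f (2 * π)) (x : ℝ) :
    |deriv (fun z => ∫ y, f (z - y) * (h⁻¹ * φ (y / h))) x|
      ≤ K / h ^ 2 * (N * ∫ y in (-π)..π, |f y|) := by
  set ψ : ℝ → ℝ := fun y => h⁻¹ * φ (y / h) with hψ
  have hψ1 : ContDiff ℝ 1 ψ := contDiff_const.mul (hφ.comp (contDiff_id.div_const h))
  have hψc : HasCompactSupport ψ := by
    have := hφc.comp_smul (c := h⁻¹) (inv_ne_zero h0.ne')
    refine (this.mul_left (f := fun _ => h⁻¹)).mono' ?_
    refine (subset_closure).trans' ?_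
    intro y hy
    simpa [hψ, div_eq_inv_mul] using hy
  have hdψ : ∀ y, deriv ψ y = h⁻¹ * (deriv φ (y / h) * h⁻¹) := by
    intro y
    have hd : HasDerivAt φ (deriv φ (y / h)) (y / h) :=
      (hφ.differentiable one_ne_zero _).hasDerivAt
    have := (hd.comp y ((hasDerivAt_id y).div_const h)).const_mul h⁻¹
    simpa [hψ, Function.comp_def] using this.deriv
  have hψK : ∀ y, |deriv ψ y| ≤ K / h ^ 2 := by
    intro y
    rw [hdψ, abs_mul, abs_mul, abs_of_pos (inv_pos.2 h0)]
    calc h⁻¹ * (|deriv φ (y / h)| * h⁻¹) = |deriv φ (y / h)| / h ^ 2 := by field_simp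
      _ ≤ K / h ^ 2 := by gcongr; exact hK _
  have hψ0 : ∀ y, y ∉ Ioc (-(N * π)) (-(N * π) + (N : ℤ) • (2 * π)) → y ≠ -(N * π) →
      deriv ψ y = 0 := by
    intro y hy hy'
    rw [hdψ, hN, zero_mul, mul_zero]
    have : N * π < |y| := by
      by_contra! hc
      rw [abs_le] at hc
      refine hy ⟨lt_of_le_of_ne hc.1 (Ne.symm hy'), ?_⟩
      simp only [zsmul_eq_mul, Int.cast_natCast]
      linarith [hc.2]
    rw [abs_div, abs_of_pos h0, lt_div_iff₀ h0]
    have : (0 : ℝ) ≤ N * π := by positivity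
    nlinarith
  have hder := hψc.hasDerivAt_convolution_left (ContinuousLinearMap.mul ℝ ℝ) (μ := volume)
    hψ1 hf.locallyIntegrable x
  have heq : (fun z => ∫ y, f (z - y) * ψ y)
      = convolution ψ f (ContinuousLinearMap.mul ℝ ℝ) volume := by
    ext z
    simp [convolution_def, mul_comm]
  rw [heq, hder.deriv, convolution_def]
  simp only [ContinuousLinearMap.mul_apply']
  have hab : -(N * π) ≤ -(N * π) + (N : ℤ) • (2 * π) := by
    simp only [zsmul_eq_mul, Int.cast_natCast]; nlinarith [pi_pos, Nat.cast_nonneg (α := ℝ) N]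
  have hper : Function.Periodic (fun y => |f (x - y)|) (2 * π) := by
    intro y
    simp only [← sub_sub, hfp.sub_eq]
  have hfx : Continuous fun y => |f (x - y)| := by fun_prop
  have hsupp : (∫ y, deriv ψ y * f (x - y))
      = ∫ y in (-(N * π))..(-(N * π) + (N : ℤ) • (2 * π)), deriv ψ y * f (x - y) := by
    rw [intervalIntegral.integral_of_le hab, ← integral_Icc_eq_integral_Ioc]
    refine (setIntegral_eq_integral_of_forall_compl_eq_zero fun y hy => ?_).symm
    rw [hψ0 y (fun hh => hy (Ioc_subset_Icc_self hh)) (by rintro rfl; exact hy (left_mem_Icc.2 hab)),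
      zero_mul]
  rw [hsupp]
  calc |∫ y in (-(N * π))..(-(N * π) + (N : ℤ) • (2 * π)), deriv ψ y * f (x - y)|
      ≤ ∫ y in (-(N * π))..(-(N * π) + (N : ℤ) • (2 * π)), K / h ^ 2 * |f (x - y)| := by
        refine intervalIntegral.norm_integral_le_of_norm_le (f := fun y => deriv ψ y * f (x - y))
          hab (.of_forall fun y _ => ?_)
          ((continuous_const.mul hfx).intervalIntegrable _ _)
        rw [Real.norm_eq_abs, abs_mul]
        gcongr
        exact hψK y
    _ = K / h ^ 2 * (N * ∫ y in (-π)..π, |f y|) := by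
        rw [intervalIntegral.integral_const_mul,
          hper.intervalIntegral_add_zsmul_eq _ _ (fun _ _ => hfx.intervalIntegrable _ _),
          zsmul_eq_mul, Int.cast_natCast,
          intervalIntegral.integral_comp_sub_left (fun y => |f y|) x]
        have := (hfp.comp abs).intervalIntegral_add_eq (x - (-(N * π) + 2 * π)) (-π)
        simp only [Function.comp_apply] at this
        rw [show x - (-(N * π) + 2 * π) + 2 * π = x - -(N * π) by ring,
          show -π + 2 * π = π by ring] at this
        rw [this]

/-- One explicit Euler step of the upwind scheme increases the `L¹` norm over a period at most by
the contribution of the source term. -/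
lemma integral_abs_upwind_step_le {z u S : ℝ → ℝ} (hz : Continuous z) (hu : Continuous u)
    (hS : Continuous S) (hzp : Function.Periodic z (2 * π)) (hup : Function.Periodic u (2 * π))
    {A : ℝ} (hA : ∀ x, |S x| ≤ A) {τ ε : ℝ} (hτ : 0 ≤ τ) (hε : 0 < ε)
    (hcfl : ∀ x, τ * (ε⁻¹ * |u x|) ≤ 1) :
    (∫ x in (-π)..π, |z x + τ * (ε⁻¹ * (z (x - ε) * max (u (x - ε)) 0
        - z x * |u x| + z (x + ε) * max (-(u (x + ε))) 0) - S x)|)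
      ≤ (∫ x in (-π)..π, |z x|) + τ * (2 * π * A) := by
  have hπ : -π ≤ π := by linarith [pi_pos]
  set p : ℝ → ℝ := fun x => |z x| * max (u x) 0 with hp
  set q : ℝ → ℝ := fun x => |z x| * max (-(u x)) 0 with hq
  have hpc : Continuous p := by fun_prop
  have hqc : Continuous q := by fun_prop
  have hpp : Function.Periodic p (2 * π) := fun x => by simp only [hp, hzp x, hup x]
  have hqp : Function.Periodic q (2 * π) := fun x => by simp only [hq, hzp x, hup x]
  have shift : ∀ {g : ℝ → ℝ}, Function.Periodic g (2 * π) → ∀ a : ℝ,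
      (∫ x in (-π)..π, g (x + a)) = ∫ x in (-π)..π, g x := by
    intro g hg a
    rw [intervalIntegral.integral_comp_add_right]
    have := hg.intervalIntegral_add_eq (-π + a) (-π)
    rwa [show -π + a + 2 * π = π + a by ring, show -π + 2 * π = π by ring] at this
  have hpq : ∀ x, |z x| * |u x| = p x + q x := by
    intro x
    simp only [hp, hq, ← mul_add]
    congr 1
    rcases le_total 0 (u x) with h | h
    · simp [abs_of_nonneg h, h]
    · simp [abs_of_nonpos h, h]
  calc _ ≤ ∫ x in (-π)..π, (|z x| + τ * ε⁻¹ * (p (x + -ε) - p x + (q (x + ε) - q x)) + τ * A) := by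
        refine intervalIntegral.integral_mono_on hπ ?_ ?_ fun x _ => ?_
        · exact Continuous.intervalIntegrable (by fun_prop) _ _
        · exact Continuous.intervalIntegrable (by fun_prop) _ _
        · have e1 : z x + τ * (ε⁻¹ * (z (x - ε) * max (u (x - ε)) 0
              - z x * |u x| + z (x + ε) * max (-(u (x + ε))) 0) - S x)
              = z x * (1 - τ * (ε⁻¹ * |u x|)) + τ * ε⁻¹ * (z (x - ε) * max (u (x - ε)) 0)
                + τ * ε⁻¹ * (z (x + ε) * max (-(u (x + ε))) 0) - τ * S x := by ring
          have hc : 0 ≤ 1 - τ * (ε⁻¹ * |u x|) := sub_nonneg.2 (hcfl x)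
          rw [e1]
          refine (abs_sub _ _).trans ?_
          refine (add_le_add_left ((abs_add_le _ _).trans
            (add_le_add_left (abs_add_le _ _) _)) _).trans ?_
          have hm1 : (0 : ℝ) ≤ max (u (x - ε)) 0 := le_max_right _ _
          have hm2 : (0 : ℝ) ≤ max (-(u (x + ε))) 0 := le_max_right _ _
          simp only [abs_mul (z _), abs_mul τ, abs_mul (τ * ε⁻¹), abs_of_nonneg hc,
            abs_of_nonneg hm1, abs_of_nonneg hm2, abs_of_nonneg hτ,
            abs_of_pos (inv_pos.2 hε)]
          have e2 : |z x| * (1 - τ * (ε⁻¹ * |u x|)) = |z x| - τ * ε⁻¹ * (p x + q x) := by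
            rw [← hpq]; ring
          have e3 := mul_le_mul_of_nonneg_left (hA x) hτ
          rw [e2]
          simp only [hp, hq, ← sub_eq_add_neg]
          linarith
    _ = (∫ x in (-π)..π, |z x|) + τ * (2 * π * A) := by
        have i : ∀ {g : ℝ → ℝ}, Continuous g → IntervalIntegrable g volume (-π) π :=
          fun hg => hg.intervalIntegrable _ _
        rw [intervalIntegral.integral_add (i (by fun_prop)) (i (by fun_prop)),
          intervalIntegral.integral_add (i (by fun_prop)) (i (by fun_prop)),
          intervalIntegral.integral_const_mul,
          intervalIntegral.integral_add (i (by fun_prop)) (i (by fun_prop)),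
          intervalIntegral.integral_sub (i (by fun_prop)) (i (by fun_prop)),
          intervalIntegral.integral_sub (i (by fun_prop)) (i (by fun_prop)),
          shift hpp, shift hqp, intervalIntegral.integral_const, smul_eq_mul]
        ring

lemma integral_abs_le_add_norm_sub (f : BoundedContinuousFunction ℝ ℝ) {g : ℝ → ℝ}
    (hg : Continuous g) {η : ℝ} (h : ∀ x, |f x - g x| ≤ η) :
    (∫ x in (-π)..π, |f x|) ≤ (∫ x in (-π)..π, |g x|) + 2 * π * η := by
  have hπ : -π ≤ π := by linarith [pi_pos]
  calc _ ≤ ∫ x in (-π)..π, (|g x| + η) := by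
        refine intervalIntegral.integral_mono_on hπ ?_ ?_ fun x _ => ?_
        · exact Continuous.intervalIntegrable (by fun_prop) _ _
        · exact Continuous.intervalIntegrable (by fun_prop) _ _
        · linarith [abs_sub_abs_le_abs_sub (f x) (g x), h x]
    _ = _ := by
        rw [intervalIntegral.integral_add (Continuous.intervalIntegrable (by fun_prop) _ _)
          (Continuous.intervalIntegrable (by fun_prop) _ _), intervalIntegral.integral_const,
          smul_eq_mul]
        ring

lemma continuous_integral_abs_bcf :
    Continuous fun f : BoundedContinuousFunction ℝ ℝ => ∫ x in (-π)..π, |f x| := by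
  refine (LipschitzWith.of_le_add_mul (Real.toNNReal (2 * π)) fun f g => ?_).continuous
  rw [Real.coe_toNNReal _ two_pi_pos.le]
  exact integral_abs_le_add_norm_sub f g.continuous fun x => by
    simpa [Real.dist_eq] using BoundedContinuousFunction.dist_coe_le_dist (f := f) (g := g) x

/-- `L¹` stability of the semi-discrete upwind scheme with a bounded source. -/
lemma integral_abs_upwind_le {ε δ M A : ℝ} (hε : 0 < ε) (hM : 0 < M)
    {u S : ℝ → ℝ → ℝ} (hu : ∀ t ∈ Icc 0 δ, Continuous fun x => u x t)
    (hup : ∀ t ∈ Icc 0 δ, Function.Periodic (fun x => u x t) (2 * π))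
    (hub : ∀ t ∈ Icc 0 δ, ∀ x, |u x t| ≤ M)
    (hA : ∀ t ∈ Icc 0 δ, ∀ x, |S x t| ≤ A)
    {Z Z' : ℝ → BoundedContinuousFunction ℝ ℝ}
    (hZp : ∀ t ∈ Icc 0 δ, Function.Periodic (Z t) (2 * π))
    (hZ : ∀ t ∈ Ici (0 : ℝ), HasDerivWithinAt Z (Z' t) (Ici 0) t)
    (hZ' : ∀ t ∈ Icc 0 δ, ∀ x, Z' t x = ε⁻¹ * (Z t (x - ε) * max (u (x - ε) t) 0
      - Z t x * |u x t| + Z t (x + ε) * max (-(u (x + ε) t)) 0) - S x t) :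
    ∀ t ∈ Icc 0 δ, (∫ x in (-π)..π, |Z t x|) ≤ (∫ x in (-π)..π, |Z 0 x|) + t * (2 * π * A) := by
  have hZc : ContinuousOn Z (Ici 0) := fun t ht => (hZ t ht).continuousWithinAt
  refine image_le_of_liminf_slope_right_le_deriv_boundary
    (f := fun t => ∫ x in (-π)..π, |Z t x|)
    (B := fun t => (∫ x in (-π)..π, |Z 0 x|) + t * (2 * π * A)) (B' := fun _ => 2 * π * A)
    (continuous_integral_abs_bcf.comp_continuousOn (hZc.mono Icc_subset_Ici_self))
    (by simp) (by fun_prop) (fun t _ => ?_) fun t ht r hr => ?_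
  · simpa using (((hasDerivAt_id t).mul_const (2 * π * A)).const_add
      (∫ x in (-π)..π, |Z 0 x|)).hasDerivWithinAt
  · have htI : t ∈ Icc 0 δ := Ico_subset_Icc_self ht
    refine Filter.Eventually.frequently ?_
    obtain ⟨η, hη, hηr⟩ : ∃ η > 0, 2 * π * A + 2 * π * η < r := by
      refine ⟨(r - 2 * π * A) / (4 * π), div_pos (sub_pos.2 hr) (by positivity), ?_⟩
      have : 2 * π * ((r - 2 * π * A) / (4 * π)) = (r - 2 * π * A) / 2 := by
        field_simp; ring
      rw [this]; linarith
    have hlo := ((hZ t ht.1).mono (Ioi_subset_Ici_self.trans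
      (Ici_subset_Ici.2 ht.1) : Ioi t ⊆ Ici 0)).isLittleO.def hη
    have hsmall : ∀ᶠ s in nhdsWithin t (Ioi t), s < t + ε / M :=
      nhdsWithin_le_nhds (eventually_lt_nhds (by linarith [div_pos hε hM]))
    filter_upwards [hlo, hsmall, self_mem_nhdsWithin] with s hs hsε hts
    have hts' : 0 < s - t := sub_pos.2 hts
    have hScont : Continuous fun x => S x t := by
      have hut := hu t htI
      have : (fun x => S x t) = fun x => ε⁻¹ * (Z t (x - ε) * max (u (x - ε) t) 0
          - Z t x * |u x t| + Z t (x + ε) * max (-(u (x + ε) t)) 0) - Z' t x := by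
        ext x; rw [hZ' t htI x]; ring
      rw [this]
      have h1 : Continuous fun x => u (x - ε) t := hut.comp (continuous_sub_right ε)
      have h2 : Continuous fun x => u (x + ε) t := hut.comp (continuous_add_const ε)
      fun_prop
    have hstep := integral_abs_upwind_step_le (Z t).continuous (hu t htI) hScont (hZp t htI)
      (hup t htI) (hA t htI) hts'.le hε (fun x => by
        have h1 : (s - t) * M ≤ ε := by
          have : s - t ≤ ε / M := by linarith
          rwa [le_div_iff₀ hM] at this
        calc (s - t) * (ε⁻¹ * |u x t|) ≤ (s - t) * (ε⁻¹ * M) := by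
              gcongr; exact hub t htI x
          _ = (s - t) * M / ε := by field_simp
          _ ≤ 1 := (div_le_one hε).2 h1)
    simp only [← hZ' t htI] at hstep
    have hclose := integral_abs_le_add_norm_sub (Z s) (g := fun x => Z t x + (s - t) * Z' t x)
      (by fun_prop) (η := η * (s - t)) (fun x => by
        have h1 := (Z s - Z t - (s - t) • Z' t).norm_coe_le_norm x
        rw [Real.norm_eq_abs (s - t), abs_of_pos hts'] at hs
        refine le_trans (le_of_eq ?_) (h1.trans hs)
        simp [Real.norm_eq_abs, sub_sub])
    rw [slope_def_field, div_lt_iff₀ hts']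
    nlinarith

/-- An a priori `L¹` estimate for the family `Z_ε` solving the discrete transport ODE
with source `−∂ₓ[(v_ε w_ε) * φ_{ε^γ}]`:
`∫_{−π}^{π}|Z_ε(x,t)|dx ≤ ∫_{−π}^{π}|Z₀ε| + t·C/ε^{2γ+(n+2)α}` on `[0,δ]`. -/
theorem stmt8 (n : ℕ) (hn : 1 ≤ n) (α : ℝ) (hα : α ∈ Ioc (0:ℝ) 1)
    (γ : ℝ) (hγ : 0 < γ) (δ : ℝ) (hδ : 0 < δ)
    (M₁ M₂ C₁ C₂ : ℝ) (hM₁ : 0 < M₁) (hM₂ : 0 < M₂) (hC₁ : 0 < C₁) (hC₂ : 0 < C₂)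
    (φ : ℝ → ℝ) (hφ : ContDiff ℝ (⊤ : ℕ∞) φ) (hφc : HasCompactSupport φ) (hφ1 : ∫ x, φ x = 1)
    (u : ℝ → ℝ → ℝ → ℝ) -- `u ε x t`
    (hu_cont : ∀ ε ∈ Ioo (0:ℝ) 1,
      ContinuousOn (fun p : ℝ × ℝ => u ε p.1 p.2) (univ ×ˢ Ici 0))
    (hu_per : ∀ ε ∈ Ioo (0:ℝ) 1, ∀ x : ℝ, ∀ t ∈ Ici (0:ℝ), u ε (x + 2*π) t = u ε x t)
    (hu_bdd : ∀ ε ∈ Ioo (0:ℝ) 1, ∀ x : ℝ, ∀ t ∈ Ici (0:ℝ), |u ε x t| ≤ M₁)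
    (v : ℝ → ℝ → ℝ → ℝ) -- `v ε x t`
    (hv_cont : ∀ ε ∈ Ioo (0:ℝ) 1,
      ContinuousOn (fun p : ℝ × ℝ => v ε p.1 p.2) (univ ×ˢ Ici 0))
    (hv_smooth : ∀ ε ∈ Ioo (0:ℝ) 1, ∀ t ∈ Ici (0:ℝ), ContDiff ℝ (⊤ : ℕ∞) (fun x => v ε x t))
    (hv_per : ∀ ε ∈ Ioo (0:ℝ) 1, ∀ x : ℝ, ∀ t ∈ Ici (0:ℝ), v ε (x + 2*π) t = v ε x t)
    (hv_bdd : ∀ ε ∈ Ioo (0:ℝ) 1, ∀ x : ℝ, ∀ t ∈ Ici (0:ℝ), |v ε x t| ≤ M₂ / ε ^ α)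
    (w : ℝ → ℝ → ℝ → ℝ) -- `w ε x t`
    (hw_cont : ∀ ε ∈ Ioo (0:ℝ) 1,
      ContinuousOn (fun p : ℝ × ℝ => w ε p.1 p.2) (univ ×ˢ Ici 0))
    (hw_per : ∀ ε ∈ Ioo (0:ℝ) 1, ∀ x : ℝ, ∀ t ∈ Ici (0:ℝ), w ε (x + 2*π) t = w ε x t)
    (hw_int : ∀ ε ∈ Ioo (0:ℝ) 1, ∀ t ∈ Icc (0:ℝ) δ,
      (∫ x in (-π)..π, |w ε x t|) ≤ C₁ / ε ^ (((n : ℝ) + 1) * α))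
    (Z₀ : ℝ → ℝ → ℝ) -- `Z₀ ε x`
    (hZ₀c : ∀ ε ∈ Ioo (0:ℝ) 1, Continuous (Z₀ ε))
    (hZ₀p : ∀ ε ∈ Ioo (0:ℝ) 1, ∀ x : ℝ, Z₀ ε (x + 2*π) = Z₀ ε x)
    (hZ₀i : ∀ ε ∈ Ioo (0:ℝ) 1, (∫ x in (-π)..π, |Z₀ ε x|) ≤ C₂)
    (Z : ℝ → ℝ → BoundedContinuousFunction ℝ ℝ) -- `Z ε t`
    (hZ0 : ∀ ε ∈ Ioo (0:ℝ) 1, ∀ x : ℝ, Z ε 0 x = Z₀ ε x)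
    (hZper : ∀ ε ∈ Ioo (0:ℝ) 1, ∀ t ∈ Ici (0:ℝ), ∀ x : ℝ, Z ε t (x + 2*π) = Z ε t x)
    (hZ : ∀ ε ∈ Ioo (0:ℝ) 1, ∃ Z' : ℝ → BoundedContinuousFunction ℝ ℝ,
      ContinuousOn Z' (Ici 0) ∧
      (∀ t ∈ Ici (0:ℝ), HasDerivWithinAt (Z ε) (Z' t) (Ici 0) t) ∧
      (∀ t ∈ Ici (0:ℝ), ∀ x : ℝ,
        Z' t x = ε⁻¹ * (Z ε t (x - ε) * max (u ε (x - ε) t) 0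
          - Z ε t x * |u ε x t| + Z ε t (x + ε) * max (-(u ε (x + ε) t)) 0)
          - deriv (fun z => ∫ y, (v ε (z - y) t * w ε (z - y) t)
              * ((ε ^ γ)⁻¹ * φ (y / ε ^ γ))) x)) :
    ∃ C > (0:ℝ), ∀ ε ∈ Ioo (0:ℝ) 1, ∀ t ∈ Icc (0:ℝ) δ,
      (∫ x in (-π)..π, |Z ε t x|) ≤
        (∫ x in (-π)..π, |Z₀ ε x|) + t * C / ε ^ (2 * γ + ((n : ℝ) + 2) * α) := by
  obtain ⟨K, hK⟩ := (hφ.continuous_deriv (by simp)).bounded_above_of_compact_support hφc.deriv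
  obtain ⟨R, hR⟩ := hφc.deriv.isBounded.exists_norm_le
  obtain ⟨N, hN⟩ := exists_nat_gt (R / π)
  have hK0 : 0 ≤ K := (norm_nonneg _).trans (hK 0)
  have hN' : ∀ y, N * π < |y| → deriv φ y = 0 := by
    intro y hy
    by_contra hne
    have h1 := hR y (subset_closure hne)
    rw [div_lt_iff₀ pi_pos] at hN
    rw [Real.norm_eq_abs] at h1
    linarith
  refine ⟨2 * π * (K * N * M₂ * C₁) + 1, by positivity, fun ε hε t ht => ?_⟩
  obtain ⟨Z', -, hd, heq⟩ := hZ ε hε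
  have hε0 : 0 < ε := hε.1
  have slice : ∀ {g : ℝ → ℝ → ℝ}, ContinuousOn (fun p : ℝ × ℝ => g p.1 p.2) (univ ×ˢ Ici 0) →
      ∀ t ∈ Ici (0 : ℝ), Continuous fun x => g x t := by
    intro g hg t ht
    exact hg.comp_continuous (f := fun x : ℝ => (x, t)) (by fun_prop) fun x => ⟨trivial, ht⟩
  have hsource : ∀ t ∈ Icc 0 δ, ∀ x,
      |deriv (fun z => ∫ y, (v ε (z - y) t * w ε (z - y) t) * ((ε ^ γ)⁻¹ * φ (y / ε ^ γ))) x|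
        ≤ K * N * M₂ * C₁ / ε ^ (2 * γ + ((n : ℝ) + 2) * α) := by
    intro t ht x
    have hvc : Continuous fun x => v ε x t := slice (hv_cont ε hε) t ht.1
    have hwc : Continuous fun x => w ε x t := slice (hw_cont ε hε) t ht.1
    refine (abs_deriv_mollify_le (f := fun x => v ε x t * w ε x t) (hφ.of_le (by simp)) hφc hK
      hN' (rpow_pos_of_pos hε0 γ) (rpow_le_one hε0.le hε.2.le hγ.le) (hvc.mul hwc)
      (fun x => by simp only [hv_per ε hε x t ht.1, hw_per ε hε x t ht.1]) x).trans ?_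
    have hvw : (∫ y in (-π)..π, |v ε y t * w ε y t|)
        ≤ M₂ / ε ^ α * (C₁ / ε ^ (((n : ℝ) + 1) * α)) := by
      calc _ ≤ ∫ y in (-π)..π, M₂ / ε ^ α * |w ε y t| := by
            refine intervalIntegral.integral_mono_on (by linarith [pi_pos])
              (Continuous.intervalIntegrable (by fun_prop) _ _)
              (Continuous.intervalIntegrable (by fun_prop) _ _) fun y _ => ?_
            rw [abs_mul]
            gcongr
            exact hv_bdd ε hε y t ht.1
        _ ≤ _ := by
            rw [intervalIntegral.integral_const_mul]
            have := rpow_pos_of_pos hε0 α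
            gcongr
            exact hw_int ε hε t ht
    have e : ε ^ (2 * γ + ((n : ℝ) + 2) * α)
        = (ε ^ γ) ^ 2 * (ε ^ α * ε ^ (((n : ℝ) + 1) * α)) := by
      rw [← rpow_natCast, ← rpow_mul hε0.le, ← rpow_add hε0, ← rpow_add hε0]
      congr 1
      push_cast
      ring
    have p1 := rpow_pos_of_pos hε0 γ
    have p2 := rpow_pos_of_pos hε0 α
    have p3 := rpow_pos_of_pos hε0 (((n : ℝ) + 1) * α)
    calc _ ≤ K / (ε ^ γ) ^ 2 * (N * (M₂ / ε ^ α * (C₁ / ε ^ (((n : ℝ) + 1) * α)))) := by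
          gcongr
      _ = _ := by rw [e]; field_simp
  have key := integral_abs_upwind_le hε0 hM₁ (u := u ε)
    (S := fun x t => deriv (fun z => ∫ y, (v ε (z - y) t * w ε (z - y) t)
      * ((ε ^ γ)⁻¹ * φ (y / ε ^ γ))) x)
    (fun t ht => slice (hu_cont ε hε) t ht.1) (fun t ht x => hu_per ε hε x t ht.1)
    (fun t ht x => hu_bdd ε hε x t ht.1) hsource (fun t ht => hZper ε hε t ht.1) hd
    (fun t ht => heq t ht.1) t ht
  simp only [hZ0 ε hε] at key
  refine key.trans ?_
  have hp := rpow_pos_of_pos hε0 (2 * γ + ((n : ℝ) + 2) * α)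
  rw [← mul_div_assoc (2 * π), ← mul_div_assoc t]
  have := ht.1
  gcongr
  linarith
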